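/- If I and J are superpermutations, then every (I,J)-super-shuffle K ∈ SSh(I,J) is a superpermutation; moreover, for any superpermutation I = (I_1,…,I_k) and any 0 ≤ i ≤ k, both std(I_1,…,I_i) and std(I_{i+1},…,I_k) are superpermutations. Consequently, the linear span sFQSym of {Q_I : I a superpermutation} is closed under the product and under the coproduct Δ of sNCQSym, i.e. sFQSym is a sub-Hopf superalgebra of sNCQSym. -/

import Mathlib

/-- A noncommutative superspace monomial: `S` records the θ-indices (taken in increasing
order) and `w` is the word of `x`-indices. -/
structure NCMon where
  S : Finset ℕ
  w : List ℕ
deriving DecidableEq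

namespace NCMon

/-- The set of indices of a noncommutative superspace monomial. -/
def ind (u : NCMon) : Finset ℕ := u.S ∪ u.w.toFinset

/-- The total degree of a noncommutative superspace monomial. -/
def deg (u : NCMon) : ℕ := u.S.card + u.w.length

end NCMon

/-- The rank of `a` in the finite set `A`: the number of elements of `A` that are `≤ a`. -/
def rk (A : Finset ℕ) (a : ℕ) : ℕ := (A.filter (· ≤ a)).card

/-- Standardization of a monomial: relabel its indices via the unique order-preserving
bijection `ind u → {1, …, k}`. -/
def NCMon.std (u : NCMon) : NCMon := ⟨u.S.image (rk u.ind), u.w.map (rk u.ind)⟩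

/-- The set supercomposition `I(u)` associated with a monomial `u`: its `r`-th block
records the (1-indexed) positions of the `r`-th smallest index in the word, together
with `0` whenever that index is a θ-index. -/
def NCMon.scomp (u : NCMon) : List (Finset ℕ) :=
  (List.range u.ind.card).map fun r₀ =>
    (((Finset.range u.w.length).filter fun t => rk u.ind (u.w.getD t 0) = r₀ + 1).image (· + 1))
      ∪ (if r₀ + 1 ∈ u.S.image (rk u.ind) then ({0} : Finset ℕ) else ∅)

/-- The monomial quasisymmetric function in noncommuting variables in superspace:
the indicator function of the monomials whose set supercomposition is `I`. -/
def Mfn (I : List (Finset ℕ)) : NCMon → ℚ := fun u => if u.scomp = I then 1 else 0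

/-- Number of inversions between two θ-supports. -/
def invST (S T : Finset ℕ) : ℕ := ((S ×ˢ T).filter fun p => p.2 < p.1).card

/-- The product of coefficient functions, induced by the signed monomial product
`(S,w)·(T,v) = 0` if `S ∩ T ≠ ∅` and `(-1)^{inv(S,T)} (S ∪ T, w·v)` otherwise. -/
def mulF (f g : NCMon → ℚ) : NCMon → ℚ := fun m =>
  ∑ k ∈ Finset.range (m.w.length + 1), ∑ S₁ ∈ m.S.powerset,
    (-1 : ℚ) ^ invST S₁ (m.S \ S₁) * f ⟨S₁, m.w.take k⟩ * g ⟨m.S \ S₁, m.w.drop k⟩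

/-- Quasisymmetry in noncommuting variables in superspace: the coefficient of a monomial
depends only on its standardization. -/
def QSymNC (f : NCMon → ℚ) : Prop := ∀ u v : NCMon, u.std = v.std → f u = f v

/-- Bounded degree. -/
def BddDeg (f : NCMon → ℚ) : Prop := ∃ N, ∀ u : NCMon, f u ≠ 0 → u.deg ≤ N

/-- The set of nonzero elements appearing in the blocks of a sequence of subsets. -/
def unionNZ (I : List (Finset ℕ)) : Finset ℕ := (I.foldr (· ∪ ·) ∅).erase 0

/-- A set supercomposition: a sequence of nonempty subsets of `{0, …, n}`, pairwise
intersecting in at most `{0}`, whose union minus `{0}` equals `{1, …, n}`. Blocks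
containing `0` are the fermionic blocks. -/
def IsSSC (I : List (Finset ℕ)) : Prop :=
  (∀ B ∈ I, B.Nonempty) ∧ I.Pairwise (fun B C => B ∩ C ⊆ {0}) ∧
    unionNZ I = Finset.Icc 1 (unionNZ I).card

/-- Shift of a block: add `n` to every positive element. -/
def shiftB (n : ℕ) (B : Finset ℕ) : Finset ℕ := B.image fun a => if a = 0 then 0 else a + n

/-- The `n`-shift `J[n]` of a set supercomposition. -/
def shiftC (n : ℕ) (J : List (Finset ℕ)) : List (Finset ℕ) := J.map (shiftB n)

/-- `L` is an interleaving (shuffle) of the block sequences `I` (tagged `false`) and `J`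
(tagged `true`), preserving the relative order of the blocks of each. -/
def IsShuffle (I J : List (Finset ℕ)) (L : List (Bool × Finset ℕ)) : Prop :=
  ((L.filter fun p => !p.1).map Prod.snd) = I ∧ ((L.filter fun p => p.1).map Prod.snd) = J

/-- `ε(L)`: the number of pairs of fermionic blocks `(I_i, J_j[n])` such that `J_j[n]`
appears before `I_i` in the tagged shuffle `L`. -/
def eps (L : List (Bool × Finset ℕ)) : ℕ :=
  ((Finset.range L.length ×ˢ Finset.range L.length).filter fun pq =>
    pq.1 < pq.2 ∧ (L.getD pq.1 (false, ∅)).1 = true ∧ 0 ∈ (L.getD pq.1 (false, ∅)).2 ∧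
      (L.getD pq.2 (false, ∅)).1 = false ∧ 0 ∈ (L.getD pq.2 (false, ∅)).2).card

/-- Covering relation on set supercompositions: merge two adjacent non-fermionic blocks,
every element of the first being smaller than every element of the second. -/
inductive SSCover : List (Finset ℕ) → List (Finset ℕ) → Prop
  | mk (pre post : List (Finset ℕ)) (B C : Finset ℕ) :
      0 ∉ B → 0 ∉ C → (∀ b ∈ B, ∀ c ∈ C, b < c) →
      SSCover (pre ++ B :: C :: post) (pre ++ (B ∪ C) :: post)

/-- The partial order on set supercompositions (reflexive-transitive closure of covering). -/
def SSle : List (Finset ℕ) → List (Finset ℕ) → Prop := Relation.ReflTransGen SSCover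

/-- The `Q`-basis: `Q_I = ∑_{J ⪰ I} M_J` (a finite sum). -/
noncomputable def Qfn (I : List (Finset ℕ)) : NCMon → ℚ :=
  ∑ᶠ (J : List (Finset ℕ)) (_ : SSle I J), Mfn J

/-- An increasing sequence of non-fermionic blocks: the maximum of each block is smaller
than the minimum of the next one. -/
def IncrRun (bs : List (Finset ℕ)) : Prop :=
  bs.Chain' (fun B C => ∀ b ∈ B, ∀ c ∈ C, b < c) ∧ ∀ B ∈ bs, 0 ∉ B

/-- `SMerge L K` : the set supercomposition `K` is obtained from the tagged shuffle `L` by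
a possibly empty collection of pairwise disjoint mergers of consecutive blocks, where
either a fermionic block from `I` is followed by an increasing sequence of non-fermionic
blocks from `J`, or an increasing sequence of non-fermionic blocks from `I` is followed by
a fermionic block from `J`, each merged group being replaced by its union. -/
inductive SMerge : List (Bool × Finset ℕ) → List (Finset ℕ) → Prop
  | nil : SMerge [] []
  | single (b : Bool) (B : Finset ℕ) (L : List (Bool × Finset ℕ)) (K : List (Finset ℕ)) :
      SMerge L K → SMerge ((b, B) :: L) (B :: K)
  | mergeI (B : Finset ℕ) (bs : List (Finset ℕ)) (L : List (Bool × Finset ℕ))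
      (K : List (Finset ℕ)) :
      0 ∈ B → IncrRun bs → bs ≠ [] → SMerge L K →
      SMerge ((false, B) :: ((bs.map fun C => (true, C)) ++ L)) ((bs.foldr (· ∪ ·) B) :: K)
  | mergeJ (bs : List (Finset ℕ)) (B : Finset ℕ) (L : List (Bool × Finset ℕ))
      (K : List (Finset ℕ)) :
      0 ∈ B → IncrRun bs → bs ≠ [] → SMerge L K →
      SMerge ((bs.map fun C => (false, C)) ++ ((true, B) :: L)) ((bs.foldr (· ∪ ·) B) :: K)

/-- Shifted concatenation `u ⋆ v` of monomials: every index of `v` is shifted above all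
indices of `u`, θ-supports are united and words are concatenated. -/
def starMon (u v : NCMon) : NCMon :=
  ⟨u.S ∪ v.S.image (· + (u.ind.sup id + 1)), u.w ++ v.w.map (· + (u.ind.sup id + 1))⟩

/-- The coproduct of a coefficient function, as a function on pairs of monomials:
`(Δf)(u, v) = f (u ⋆ v)`. -/
def DeltaF (f : NCMon → ℚ) : NCMon → NCMon → ℚ := fun u v => f (starMon u v)

/-- Standardization of a finite sequence of subsets of `ℕ₀`: the nonzero elements are
replaced by `{1, …, n}` via the unique order-preserving bijection, keeping the `0`s. -/
def stdSeq (I : List (Finset ℕ)) : List (Finset ℕ) :=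
  I.map fun B => B.image fun a => if a = 0 then 0 else rk (unionNZ I) a

/-- A superpermutation: a set supercomposition all of whose non-fermionic blocks are
singletons. -/
def IsSuperPerm (I : List (Finset ℕ)) : Prop :=
  IsSSC I ∧ ∀ B ∈ I, 0 ∉ B → B.card = 1

/-- The span of the `Q`-functions indexed by superpermutations: the space of free
quasisymmetric functions in superspace. -/
noncomputable def sFQSym : Submodule ℚ (NCMon → ℚ) :=
  Submodule.span ℚ {f | ∃ I : List (Finset ℕ), IsSuperPerm I ∧ f = Qfn I}

/-! ### Multiplicities and set supercompositions -/

/-- The number of blocks of `K` containing `x`. -/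
def blockCount (x : ℕ) (K : List (Finset ℕ)) : ℕ := K.countP fun B => x ∈ B

lemma blockCount_cons (x : ℕ) (B : Finset ℕ) (K : List (Finset ℕ)) :
    blockCount x (B :: K) = blockCount x K + if x ∈ B then 1 else 0 := by
  simp [blockCount, List.countP_cons]

lemma blockCount_append (x : ℕ) (K L : List (Finset ℕ)) :
    blockCount x (K ++ L) = blockCount x K + blockCount x L := by
  simp [blockCount]

lemma blockCount_pos {x : ℕ} {K : List (Finset ℕ)} :
    0 < blockCount x K ↔ ∃ B ∈ K, x ∈ B := by
  simp [blockCount, List.countP_pos_iff]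

lemma mem_foldr_union {x : ℕ} {A : Finset ℕ} {K : List (Finset ℕ)} :
    x ∈ K.foldr (· ∪ ·) A ↔ (∃ B ∈ K, x ∈ B) ∨ x ∈ A := by
  induction K with
  | nil => simp
  | cons B K ih => simp [ih, or_assoc]

lemma mem_unionNZ {x : ℕ} {K : List (Finset ℕ)} :
    x ∈ unionNZ K ↔ x ≠ 0 ∧ ∃ B ∈ K, x ∈ B := by
  simp [unionNZ, mem_foldr_union]

lemma pairwise_inter_iff {K : List (Finset ℕ)} :
    K.Pairwise (fun B C => B ∩ C ⊆ {0}) ↔ ∀ x ≠ 0, blockCount x K ≤ 1 := by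
  induction K with
  | nil => simp [blockCount]
  | cons B K ih =>
    simp only [List.pairwise_cons, ih, blockCount_cons]
    constructor
    · rintro ⟨h1, h2⟩ x hx
      split_ifs with hB
      · have : ¬ 0 < blockCount x K := by
          rw [blockCount_pos]
          rintro ⟨C, hC, hxC⟩
          have := h1 C hC (Finset.mem_inter.2 ⟨hB, hxC⟩)
          simp_all
        omega
      · simpa using h2 x hx
    · intro h
      refine ⟨fun C hC x hx => ?_, fun x hx => by have := h x hx; omega⟩
      rw [Finset.mem_inter] at hx
      by_contra h0
      have := h x (by simpa using h0)
      have := blockCount_pos.2 ⟨C, hC, hx.2⟩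
      simp only [hx.1, if_true] at *
      omega

lemma unionNZ_eq_Icc {K : List (Finset ℕ)} {n : ℕ}
    (h : ∀ x ≠ 0, blockCount x K = if x ≤ n then 1 else 0) : unionNZ K = Finset.Icc 1 n := by
  ext x
  rw [mem_unionNZ, ← blockCount_pos, Finset.mem_Icc]
  by_cases hx : x = 0
  · simp [hx]
  · rw [h x hx]
    split_ifs <;> simp_all; omega

lemma isSSC_of_blockCount {K : List (Finset ℕ)} {n : ℕ} (hne : ∀ B ∈ K, B.Nonempty)
    (h : ∀ x ≠ 0, blockCount x K = if x ≤ n then 1 else 0) : IsSSC K := by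
  refine ⟨hne, pairwise_inter_iff.2 fun x hx => ?_, ?_⟩
  · rw [h x hx]; split_ifs <;> simp
  · rw [unionNZ_eq_Icc h]; simp

lemma IsSSC.blockCount_eq {K : List (Finset ℕ)} (h : IsSSC K) {x : ℕ} (hx : x ≠ 0) :
    blockCount x K = if x ≤ (unionNZ K).card then 1 else 0 := by
  have h1 := pairwise_inter_iff.1 h.2.1 x hx
  have h2 : x ∈ unionNZ K ↔ x ∈ Finset.Icc 1 (unionNZ K).card := by rw [← h.2.2]
  rw [mem_unionNZ, ← blockCount_pos, Finset.mem_Icc] at h2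
  split_ifs with hn
  · have := (h2.2 ⟨by omega, hn⟩).2
    omega
  · by_contra h0
    exact hn (h2.1 ⟨hx, by omega⟩).2

/-! ### Super-shuffles of superpermutations -/

lemma mem_shiftB {n x : ℕ} {B : Finset ℕ} (hx : x ≠ 0) :
    x ∈ shiftB n B ↔ n < x ∧ x - n ∈ B ∨ n = 0 ∧ x ∈ B := by
  simp only [shiftB, Finset.mem_image]
  constructor
  · rintro ⟨a, ha, rfl⟩
    split_ifs at hx ⊢ with h
    · simp at hx
    · left
      exact ⟨by omega, by simpa using ha⟩
  · rintro (⟨h1, h2⟩ | ⟨rfl, h2⟩)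
    · exact ⟨x - n, h2, by rw [if_neg (by omega)]; omega⟩
    · exact ⟨x, h2, by simp [hx]⟩

lemma zero_mem_shiftB {n : ℕ} {B : Finset ℕ} : 0 ∈ shiftB n B ↔ 0 ∈ B := by
  simp only [shiftB, Finset.mem_image]
  constructor
  · rintro ⟨a, ha, h⟩
    split_ifs at h with h0
    · exact h0 ▸ ha
    · omega
  · exact fun h => ⟨0, h, by simp⟩

lemma blockCount_shiftC {n x : ℕ} {J : List (Finset ℕ)} (hx : x ≠ 0) :
    blockCount x (shiftC n J) = if x ≤ n then 0 else blockCount (x - n) J := by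
  induction J with
  | nil => simp [shiftC, blockCount]
  | cons B J ih =>
    rw [shiftC, List.map_cons, ← shiftC, blockCount_cons, blockCount_cons, ih]
    simp only [mem_shiftB hx]
    by_cases h : x ≤ n
    · have h1 : ¬ (n < x ∧ x - n ∈ B ∨ n = 0 ∧ x ∈ B) := by omega
      rw [if_pos h, if_pos h, if_neg h1]
    · have h1 : (n < x ∧ x - n ∈ B ∨ n = 0 ∧ x ∈ B) ↔ x - n ∈ B := by
        constructor
        · rintro (⟨-, h⟩ | ⟨rfl, h⟩) <;> simpa
        · intro h2; exact Or.inl ⟨by omega, h2⟩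
      simp [h, h1]

lemma blockCount_foldr_union_le (x : ℕ) (B : Finset ℕ) (bs : List (Finset ℕ)) :
    (if x ∈ bs.foldr (· ∪ ·) B then 1 else 0) ≤ blockCount x bs + if x ∈ B then 1 else 0 := by
  split_ifs with h h'
  · omega
  · rw [mem_foldr_union, or_iff_left h', ← blockCount_pos] at h
    omega
  · omega
  · omega

lemma SMerge.blockCount_le {L : List (Bool × Finset ℕ)} {K : List (Finset ℕ)} (h : SMerge L K)
    (x : ℕ) : blockCount x K ≤ blockCount x (L.map Prod.snd) := by
  induction h with
  | nil => simp
  | single b B L K _ ih => simpa [blockCount_cons] using ih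
  | mergeI B bs L K _ _ _ _ ih =>
    have := blockCount_foldr_union_le x B bs
    simp only [blockCount_cons, blockCount_append, List.map_cons, List.map_append, List.map_map,
      Function.comp_def, List.map_id_fun', id]
    omega
  | mergeJ bs B L K _ _ _ _ ih =>
    have := blockCount_foldr_union_le x B bs
    simp only [blockCount_cons, blockCount_append, List.map_cons, List.map_append, List.map_map,
      Function.comp_def, List.map_id_fun', id]
    omega

lemma SMerge.blockCount_pos_iff {L : List (Bool × Finset ℕ)} {K : List (Finset ℕ)}
    (h : SMerge L K) (x : ℕ) : 0 < blockCount x K ↔ 0 < blockCount x (L.map Prod.snd) := by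
  rw [blockCount_pos, blockCount_pos]
  induction h with
  | nil => simp
  | single b B L K _ ih => simp_all
  | mergeI B bs L K _ _ _ _ ih =>
    simp only [List.map_cons, List.map_append, List.map_map, Function.comp_def, List.map_id_fun',
      id, List.mem_cons, List.mem_append, or_and_right, exists_or, exists_eq_left,
      mem_foldr_union, ih]
    rw [or_comm (b := x ∈ B), or_assoc]
  | mergeJ bs B L K _ _ _ _ ih =>
    simp only [List.map_cons, List.map_append, List.map_map, Function.comp_def, List.map_id_fun',
      id, List.mem_cons, List.mem_append, or_and_right, exists_or, exists_eq_left,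
      mem_foldr_union, ih]
    rw [or_assoc]

/-- The blocks of a super-shuffle are blocks of the shuffle or fermionic unions. -/
lemma SMerge.mem_or_zero_mem {L : List (Bool × Finset ℕ)} {K : List (Finset ℕ)}
    (h : SMerge L K) : ∀ B ∈ K, B ∈ L.map Prod.snd ∨ 0 ∈ B := by
  induction h with
  | nil => simp
  | single b B L K _ ih =>
    intro C hC
    rw [List.mem_cons] at hC
    rw [List.map_cons, List.mem_cons]
    exact hC.elim (fun h => Or.inl (Or.inl h)) fun h => (ih C h).imp_left Or.inr
  | mergeI B bs L K h0 _ _ _ ih =>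
    intro C hC
    rw [List.mem_cons] at hC
    rcases hC with rfl | hC
    · exact Or.inr (mem_foldr_union.2 (Or.inr h0))
    · rcases ih C hC with h | h
      · left; simp only [List.map_cons, List.map_append, List.mem_cons, List.mem_append]; tauto
      · exact Or.inr h
  | mergeJ bs B L K h0 _ _ _ ih =>
    intro C hC
    rw [List.mem_cons] at hC
    rcases hC with rfl | hC
    · exact Or.inr (mem_foldr_union.2 (Or.inr h0))
    · rcases ih C hC with h | h
      · left; simp only [List.map_cons, List.map_append, List.mem_cons, List.mem_append]; tauto
      · exact Or.inr h

lemma IsShuffle.perm {I J : List (Finset ℕ)} {L : List (Bool × Finset ℕ)} (h : IsShuffle I J L) :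
    (L.map Prod.snd).Perm (I ++ J) := by
  rw [← h.1, ← h.2, ← List.map_append]
  exact (((List.filter_append_perm (fun p => p.1) L).symm).trans List.perm_append_comm).map _

lemma IsSuperPerm.of_superShuffle {I J : List (Finset ℕ)} (hI : IsSuperPerm I)
    (hJ : IsSuperPerm J) {L : List (Bool × Finset ℕ)} {K : List (Finset ℕ)}
    (hL : IsShuffle I (shiftC (unionNZ I).card J) L) (hK : SMerge L K) : IsSuperPerm K := by
  have hmem : ∀ B ∈ L.map Prod.snd, B.Nonempty ∧ (0 ∉ B → B.card = 1) := by
    intro B hB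
    rw [hL.perm.mem_iff, List.mem_append] at hB
    rcases hB with hB | hB
    · exact ⟨hI.1.1 B hB, hI.2 B hB⟩
    · obtain ⟨C, hC, rfl⟩ := List.mem_map.1 hB
      refine ⟨(hJ.1.1 C hC).image _, fun h0 => le_antisymm ?_ ?_⟩
      · rw [← hJ.2 C hC (fun h => h0 (zero_mem_shiftB.2 h))]
        exact Finset.card_image_le
      · exact Finset.card_pos.2 ((hJ.1.1 C hC).image _)
  have hcount : ∀ x ≠ 0, blockCount x (L.map Prod.snd) =
      if x ≤ (unionNZ I).card + (unionNZ J).card then 1 else 0 := by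
    intro x hx
    have : blockCount x (L.map Prod.snd) = _ := hL.perm.countP_eq _
    rw [this, ← blockCount, blockCount_append, blockCount_shiftC hx, hI.1.blockCount_eq hx]
    by_cases h : x ≤ (unionNZ I).card
    · simp [h, le_add_right h]
    · rw [hJ.1.blockCount_eq (by omega)]
      simp only [h, if_false]
      split_ifs <;> omega
  refine ⟨isSSC_of_blockCount (n := (unionNZ I).card + (unionNZ J).card) (fun B hB => ?_)
    fun x hx => ?_, fun B hB h0 => ?_⟩
  · rcases hK.mem_or_zero_mem B hB with h | h
    · exact (hmem B h).1
    · exact ⟨0, h⟩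
  · have h1 := hK.blockCount_le x
    have h2 := hK.blockCount_pos_iff x
    rw [hcount x hx] at h1 h2
    split_ifs at * <;> omega
  · rcases hK.mem_or_zero_mem B hB with h | h
    · exact (hmem B h).2 h0
    · exact absurd h h0

/-! ### Ranks and standardization -/

lemma rk_strictMonoOn (A : Finset ℕ) : StrictMonoOn (rk A) A := by
  intro a _ b hb hab
  refine Finset.card_lt_card (Finset.ssubset_iff_of_subset ?_ |>.2 ⟨b, ?_, ?_⟩)
  · intro x; simp only [Finset.mem_filter]; exact fun h => ⟨h.1, by omega⟩
  · simpa using hb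
  · simp [hab]

lemma rk_pos {A : Finset ℕ} {a : ℕ} (ha : a ∈ A) : 0 < rk A a :=
  Finset.card_pos.2 ⟨a, by simpa using ha⟩

lemma image_rk (A : Finset ℕ) : A.image (rk A) = Finset.Icc 1 A.card := by
  refine Finset.eq_of_subset_of_card_le ?_ ?_
  · intro x hx
    obtain ⟨a, ha, rfl⟩ := Finset.mem_image.1 hx
    exact Finset.mem_Icc.2 ⟨rk_pos ha, Finset.card_filter_le _ _⟩
  · rw [Finset.card_image_of_injOn (rk_strictMonoOn A).injOn]; simp

lemma isSuperPerm_stdSeq {K : List (Finset ℕ)} (hne : ∀ B ∈ K, B.Nonempty)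
    (hpw : K.Pairwise (fun B C => B ∩ C ⊆ {0})) (hcard : ∀ B ∈ K, 0 ∉ B → B.card = 1) :
    IsSuperPerm (stdSeq K) := by
  have hrk : ∀ B ∈ K, ∀ a ∈ B, a ≠ 0 → a ∈ unionNZ K :=
    fun B hB a ha h0 => mem_unionNZ.2 ⟨h0, B, hB, ha⟩
  refine ⟨isSSC_of_blockCount (n := (unionNZ K).card) ?_ fun x hx => ?_, ?_⟩
  · intro B hB
    obtain ⟨C, hC, rfl⟩ := List.mem_map.1 hB
    exact (hne C hC).image _
  · have hmem : ∀ y ∈ unionNZ K, ∀ B ∈ K,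
        (rk (unionNZ K) y ∈ (B.image fun a => if a = 0 then 0 else rk (unionNZ K) a) ↔ y ∈ B) := by
      intro y hy B hB
      rw [Finset.mem_image]
      constructor
      · rintro ⟨a, ha, h⟩
        split_ifs at h with h0
        · exact absurd (rk_pos hy) (by omega)
        · rwa [← (rk_strictMonoOn _).injOn (hrk B hB a ha h0) hy h]
      · exact fun h => ⟨y, h, if_neg (mem_unionNZ.1 hy).1⟩
    split_ifs with hxn
    · have : x ∈ (unionNZ K).image (rk (unionNZ K)) := by
        rw [image_rk, Finset.mem_Icc]; omega
      obtain ⟨y, hy, rfl⟩ := Finset.mem_image.1 this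
      have hcount : blockCount (rk (unionNZ K) y) (stdSeq K) = blockCount y K := by
        rw [blockCount, stdSeq, List.countP_map, blockCount]
        exact List.countP_congr fun B hB => by simpa using hmem y hy B hB
      rw [hcount]
      obtain ⟨hy0, hy⟩ := mem_unionNZ.1 hy
      have := pairwise_inter_iff.1 hpw y hy0
      have := blockCount_pos.2 hy
      omega
    · by_contra h
      obtain ⟨B, hB, hxB⟩ := blockCount_pos.1 (Nat.pos_of_ne_zero h)
      obtain ⟨C, hC, rfl⟩ := List.mem_map.1 hB
      obtain ⟨a, ha, rfl⟩ := Finset.mem_image.1 hxB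
      split_ifs at hx hxn with h0
      · exact hx rfl
      · exact hxn (Finset.card_filter_le _ _)
  · intro B hB h0
    obtain ⟨C, hC, rfl⟩ := List.mem_map.1 hB
    refine le_antisymm ?_ (Finset.card_pos.2 ((hne C hC).image _))
    rw [← hcard C hC fun h => h0 (Finset.mem_image.2 ⟨0, h, by simp⟩)]
    exact Finset.card_image_le

lemma IsSuperPerm.stdSeq_of_sublist {I K : List (Finset ℕ)} (hI : IsSuperPerm I)
    (h : K.Sublist I) : IsSuperPerm (stdSeq K) :=
  isSuperPerm_stdSeq (fun B hB => hI.1.1 B (h.subset hB)) (hI.1.2.1.sublist h)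
    fun B hB => hI.2 B (h.subset hB)

/-! ### Splitting non-fermionic blocks into singletons -/

/-- The finest sequence of blocks below `B`: fermionic blocks are kept, non-fermionic ones are
split into the increasing sequence of their singletons. -/
def splitBlock (B : Finset ℕ) : List (Finset ℕ) :=
  if 0 ∈ B then [B] else B.sort.map fun x => {x}

/-- Split all the non-fermionic blocks of `K` into singletons. -/
def splitBlocks (K : List (Finset ℕ)) : List (Finset ℕ) := K.flatMap splitBlock

lemma mem_splitBlock {B C : Finset ℕ} :
    C ∈ splitBlock B ↔ 0 ∈ B ∧ C = B ∨ 0 ∉ B ∧ ∃ x ∈ B, C = {x} := by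
  by_cases h : 0 ∈ B <;> simp [splitBlock, h, eq_comm]

lemma subset_of_mem_splitBlock {B C : Finset ℕ} (h : C ∈ splitBlock B) : C ⊆ B := by
  rcases mem_splitBlock.1 h with ⟨-, rfl⟩ | ⟨-, x, hx, rfl⟩
  · rfl
  · simpa using hx

lemma blockCount_splitBlock (x : ℕ) (B : Finset ℕ) :
    blockCount x (splitBlock B) = if x ∈ B then 1 else 0 := by
  by_cases h : 0 ∈ B
  · simp [splitBlock, h, blockCount, List.countP_cons]
  · simp only [splitBlock, h, if_false, blockCount, List.countP_map]
    have : List.countP ((fun C : Finset ℕ => decide (x ∈ C)) ∘ fun y => {y}) B.sort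
        = B.sort.count x := List.countP_congr fun y _ => by simpa using eq_comm
    rw [this]
    split_ifs with hx
    · exact List.count_eq_one_of_mem (B.sort_nodup _) (by simpa using hx)
    · exact List.count_eq_zero_of_not_mem (by simpa using hx)

/-- A finset that is an increasing disjoint union has the concatenation of the sorted parts as its
sorted list. -/
lemma sort_eq_flatMap {α : Type*} {l : List α} {F : α → Finset ℕ} {T : Finset ℕ}
    (hl : l.Pairwise fun a b => ∀ x ∈ F a, ∀ y ∈ F b, x < y)
    (hT : ∀ x, x ∈ T ↔ ∃ a ∈ l, x ∈ F a) : T.sort = l.flatMap fun a => (F a).sort := by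
  refine T.sortedLT_sort.eq_of_mem_iff (List.Pairwise.sortedLT ?_) fun x => ?_
  · rw [List.pairwise_flatMap]
    exact ⟨fun a _ => (F a).sortedLT_sort.pairwise, hl.imp fun h => by simpa using h⟩
  · simp [hT]

lemma splitBlock_eq_flatMap {α : Type*} {l : List α} {F : α → Finset ℕ} {T : Finset ℕ}
    (hl : l.Pairwise fun a b => ∀ x ∈ F a, ∀ y ∈ F b, x < y)
    (hT : ∀ x, x ∈ T ↔ ∃ a ∈ l, x ∈ F a) (h0 : 0 ∉ T) :
    splitBlock T = l.flatMap fun a => splitBlock (F a) := by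
  rw [splitBlock, if_neg h0, sort_eq_flatMap hl hT, List.map_flatMap]
  refine List.flatMap_congr fun a ha => ?_
  rw [splitBlock, if_neg fun h => h0 ((hT 0).2 ⟨a, ha, h⟩)]

lemma SSCover.splitBlocks_eq {I J : List (Finset ℕ)} (h : SSCover I J) :
    splitBlocks J = splitBlocks I := by
  obtain ⟨pre, post, B, C, hB, hC, hBC⟩ := h
  have := splitBlock_eq_flatMap (l := [B, C]) (F := id) (T := B ∪ C) (by simpa using hBC)
    (by simp) (by simp [hB, hC])
  simp only [splitBlocks, List.flatMap_append, List.flatMap_cons, this]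
  simp

lemma SSle.splitBlocks_eq {I J : List (Finset ℕ)} (h : SSle I J) :
    splitBlocks J = splitBlocks I := by
  induction h with
  | refl => rfl
  | tail _ h ih => rw [h.splitBlocks_eq, ih]

lemma IsSuperPerm.splitBlocks_eq {I : List (Finset ℕ)} (h : IsSuperPerm I) :
    splitBlocks I = I := by
  have : ∀ B ∈ I, splitBlock B = [B] := by
    intro B hB
    by_cases h0 : 0 ∈ B
    · simp [splitBlock, h0]
    · obtain ⟨x, rfl⟩ := Finset.card_eq_one.1 (h.2 B hB h0)
      simp [splitBlock, h0]
  rw [splitBlocks, List.flatMap_congr this, List.flatMap_singleton']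

lemma SSCover.append_append {I J : List (Finset ℕ)} (h : SSCover I J) (X Y : List (Finset ℕ)) :
    SSCover (X ++ I ++ Y) (X ++ J ++ Y) := by
  obtain ⟨pre, post, B, C, hB, hC, hBC⟩ := h
  simpa using SSCover.mk (X ++ pre) (post ++ Y) B C hB hC hBC

lemma SSle.append_append {I J : List (Finset ℕ)} (h : SSle I J) (X Y : List (Finset ℕ)) :
    SSle (X ++ I ++ Y) (X ++ J ++ Y) :=
  Relation.ReflTransGen.lift (fun K => X ++ K ++ Y)
    (fun _ _ (h : SSCover _ _) => h.append_append X Y) I J h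

lemma ssle_toFinset {l : List ℕ} (hne : l ≠ []) (hl : l.Pairwise (· < ·)) (h0 : 0 ∉ l) :
    SSle (l.map fun x => {x}) [l.toFinset] := by
  induction l with
  | nil => simp at hne
  | cons a l ih =>
    rw [List.pairwise_cons] at hl
    by_cases h : l = []
    · subst h
      exact Relation.ReflTransGen.refl
    · rw [List.mem_cons, not_or] at h0
      have h1 := (ih h hl.2 h0.2).append_append [{a}] []
      have h2 := SSCover.mk [] [] {a} l.toFinset (by simpa using h0.1) (by simpa using h0.2)
        (by simpa using hl.1)
      have h3 : SSle ([{a}] ++ l.map (fun x => {x}) ++ []) [{a} ∪ l.toFinset] :=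
        h1.tail (by simpa using h2)
      rwa [List.append_nil, ← Finset.insert_eq, ← List.toFinset_cons] at h3

lemma ssle_splitBlock {B : Finset ℕ} (hB : B.Nonempty) : SSle (splitBlock B) [B] := by
  by_cases h : 0 ∈ B
  · rw [splitBlock, if_pos h]
    exact Relation.ReflTransGen.refl
  · rw [splitBlock, if_neg h]
    have := ssle_toFinset (l := B.sort) (fun h0 => by
      have := B.sort_toFinset (· ≤ ·)
      rw [h0] at this
      exact hB.ne_empty (by simpa using this.symm)) B.sortedLT_sort.pairwise (by simpa using h)
    rwa [Finset.sort_toFinset] at this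

lemma ssle_splitBlocks {J : List (Finset ℕ)} (hJ : ∀ B ∈ J, B.Nonempty) :
    SSle (splitBlocks J) J := by
  induction J with
  | nil => exact Relation.ReflTransGen.refl
  | cons B J ih =>
    have h1 := (ssle_splitBlock (hJ B (by simp))).append_append [] (splitBlocks J)
    have h2 := (ih fun C hC => hJ C (by simp [hC])).append_append [B] []
    have h3 : SSle (splitBlocks (B :: J)) (B :: splitBlocks J) := by
      simpa [splitBlocks] using h1
    exact Relation.ReflTransGen.trans h3 (by rwa [List.append_nil, List.append_nil] at h2)

lemma IsSuperPerm.ssle_iff {I J : List (Finset ℕ)} (hI : IsSuperPerm I)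
    (hJ : ∀ B ∈ J, B.Nonempty) : SSle I J ↔ splitBlocks J = I :=
  ⟨fun h => h.splitBlocks_eq.trans hI.splitBlocks_eq, fun h => h ▸ ssle_splitBlocks hJ⟩

/-! ### Finiteness -/

lemma finite_lists_of_subset {N : ℕ} {T : Finset ℕ} :
    {K : List (Finset ℕ) | K.length ≤ N ∧ ∀ B ∈ K, B ⊆ T}.Finite := by
  refine ((List.finite_length_le T.powerset N).image (List.map Subtype.val)).subset ?_
  rintro K ⟨hK, hT⟩
  refine ⟨K.attachWith (· ∈ T.powerset) fun B hB => Finset.mem_powerset.2 (hT B hB), ?_, ?_⟩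
  · simpa using hK
  · simp

lemma SSle.length_le {I J : List (Finset ℕ)} (h : SSle I J) : J.length ≤ I.length := by
  induction h with
  | refl => rfl
  | tail _ h ih =>
    obtain ⟨pre, post, B, C, -, -, -⟩ := h
    simp at ih ⊢
    omega

lemma SSle.foldr_union_eq {I J : List (Finset ℕ)} (h : SSle I J) :
    J.foldr (· ∪ ·) ∅ = I.foldr (· ∪ ·) ∅ := by
  induction h with
  | refl => rfl
  | tail _ h ih =>
    obtain ⟨pre, post, B, C, -, -, -⟩ := h
    rw [← ih]
    simp [List.foldr_append, Finset.union_assoc]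

lemma finite_ssle (I : List (Finset ℕ)) : {J | SSle I J}.Finite := by
  refine (finite_lists_of_subset (N := I.length) (T := I.foldr (· ∪ ·) ∅)).subset ?_
  intro J hJ
  refine ⟨SSle.length_le hJ, fun B hB x hx => ?_⟩
  rw [← SSle.foldr_union_eq hJ]
  exact mem_foldr_union.2 (Or.inl ⟨B, hB, hx⟩)

open Classical in
lemma Qfn_apply (I : List (Finset ℕ)) (u : NCMon) :
    Qfn I u = if SSle I u.scomp then 1 else 0 := by
  have : Qfn I = ∑ J ∈ (finite_ssle I).toFinset, Mfn J :=
    finsum_mem_eq_finite_toFinset_sum _ (finite_ssle I)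
  rw [this, Finset.sum_apply]
  simp [Mfn]

/-! ### The superpermutation of a monomial -/

namespace NCMon

/-- The block of positions of the index `a` in the monomial `u`. -/
def block (u : NCMon) (a : ℕ) : Finset ℕ :=
  (((Finset.range u.w.length).filter fun t => u.w.getD t 0 = a).image (· + 1)) ∪
    (if a ∈ u.S then ({0} : Finset ℕ) else ∅)

lemma zero_mem_block {u : NCMon} {a : ℕ} : 0 ∈ u.block a ↔ a ∈ u.S := by
  by_cases h : a ∈ u.S <;> simp [block, h]

lemma succ_mem_block {u : NCMon} {a t : ℕ} : t + 1 ∈ u.block a ↔ u.w[t]? = some a := by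
  have : t + 1 ∉ (if a ∈ u.S then ({0} : Finset ℕ) else ∅) := by split_ifs <;> simp
  simp only [block, Finset.mem_union, this, or_false, Finset.mem_image, Finset.mem_filter,
    Finset.mem_range, Nat.add_right_cancel_iff, exists_eq_right]
  by_cases h : t < u.w.length <;> simp [h]

lemma mem_ind {u : NCMon} {a : ℕ} : a ∈ u.ind ↔ a ∈ u.S ∨ a ∈ u.w := by simp [ind]

lemma block_nonempty {u : NCMon} {a : ℕ} (ha : a ∈ u.ind) : (u.block a).Nonempty := by
  rcases mem_ind.1 ha with h | h
  · exact ⟨0, zero_mem_block.2 h⟩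
  · obtain ⟨t, ht⟩ := List.mem_iff_getElem?.1 h
    exact ⟨t + 1, succ_mem_block.2 ht⟩

lemma sort_map_rk (A : Finset ℕ) : A.sort.map (rk A) = (List.range A.card).map (· + 1) := by
  refine List.SortedLT.eq_of_mem_iff (List.Pairwise.sortedLT ?_) (List.Pairwise.sortedLT ?_) ?_
  · rw [List.pairwise_map]
    exact A.sortedLT_sort.pairwise.imp_of_mem fun ha hb h =>
      rk_strictMonoOn A (by simpa using ha) (by simpa using hb) h
  · rw [List.pairwise_map]
    exact List.pairwise_lt_range.imp fun h => by omega
  · intro x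
    have h : x ∈ A.image (rk A) ↔ 1 ≤ x ∧ x ≤ A.card := by rw [image_rk, Finset.mem_Icc]
    simp only [Finset.mem_image] at h
    simp only [List.mem_map, Finset.mem_sort, h, List.mem_range]
    constructor
    · exact fun h => ⟨x - 1, by omega⟩
    · rintro ⟨a, ha, rfl⟩; omega

lemma scomp_eq (u : NCMon) : u.scomp = u.ind.sort.map u.block := by
  set G : ℕ → Finset ℕ := fun r =>
    (((Finset.range u.w.length).filter fun t => rk u.ind (u.w.getD t 0) = r).image (· + 1))
      ∪ (if r ∈ u.S.image (rk u.ind) then ({0} : Finset ℕ) else ∅) with hG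
  have h1 : u.scomp = ((List.range u.ind.card).map (· + 1)).map G := by
    rw [List.map_map]; rfl
  rw [h1, ← sort_map_rk, List.map_map]
  refine List.map_congr_left fun a ha => ?_
  rw [Finset.mem_sort] at ha
  have hinj := (rk_strictMonoOn u.ind).injOn
  have hS : rk u.ind a ∈ u.S.image (rk u.ind) ↔ a ∈ u.S := by
    rw [Finset.mem_image]
    exact ⟨fun ⟨b, hb, h⟩ => hinj (mem_ind.2 (Or.inl hb)) ha h ▸ hb, fun h => ⟨a, h, rfl⟩⟩
  simp only [Function.comp, hG, block, hS]
  congr 2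
  refine Finset.filter_congr fun t ht => ?_
  have : u.w.getD t 0 ∈ u.ind := by
    rw [Finset.mem_range] at ht
    rw [List.getD_eq_getElem _ _ ht]
    exact mem_ind.2 (Or.inr (List.getElem_mem ht))
  exact ⟨fun h => hinj this ha h, fun h => by rw [h]⟩

/-- The finest set supercomposition below `I(u)`. -/
def superPerm (u : NCMon) : List (Finset ℕ) := splitBlocks u.scomp

lemma superPerm_eq (u : NCMon) :
    u.superPerm = u.ind.sort.flatMap fun a => splitBlock (u.block a) := by
  rw [superPerm, splitBlocks, scomp_eq, List.flatMap_map]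

lemma mem_superPerm {u : NCMon} {B : Finset ℕ} :
    B ∈ u.superPerm ↔ ∃ a ∈ u.ind, B ∈ splitBlock (u.block a) := by
  simp [superPerm_eq]

lemma blockCount_superPerm (u : NCMon) {x : ℕ} (hx : x ≠ 0) :
    blockCount x u.superPerm = if x ≤ u.w.length then 1 else 0 := by
  obtain ⟨t, rfl⟩ := Nat.exists_eq_succ_of_ne_zero hx
  have h1 : blockCount (t + 1) u.superPerm = u.ind.sort.countP fun a => t + 1 ∈ u.block a := by
    rw [superPerm_eq, blockCount, List.countP_flatMap]
    induction u.ind.sort with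
    | nil => rfl
    | cons a l ih =>
      rw [List.map_cons, List.sum_cons, ih, List.countP_cons, add_comm]
      simpa [blockCount] using blockCount_splitBlock (t + 1) (u.block a)
  rw [Nat.succ_eq_add_one, h1]
  by_cases h : t < u.w.length
  · rw [if_pos (by omega)]
    have : (u.ind.sort.countP fun a => t + 1 ∈ u.block a) = u.ind.sort.count u.w[t] :=
      List.countP_congr fun a _ => by simpa [succ_mem_block, h] using eq_comm
    rw [this]
    exact List.count_eq_one_of_mem (u.ind.sort_nodup _)
      (by simpa using mem_ind.2 (Or.inr (List.getElem_mem h)))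
  · rw [if_neg (by omega), List.countP_eq_zero]
    intro a _
    simp [succ_mem_block, h]

lemma isSuperPerm_superPerm (u : NCMon) : IsSuperPerm u.superPerm := by
  refine ⟨isSSC_of_blockCount (fun B hB => ?_) fun x hx => u.blockCount_superPerm hx,
    fun B hB h0 => ?_⟩
  · obtain ⟨a, ha, h⟩ := mem_superPerm.1 hB
    rcases mem_splitBlock.1 h with ⟨-, rfl⟩ | ⟨-, x, hx, rfl⟩
    · exact block_nonempty ha
    · simp
  · obtain ⟨a, ha, h⟩ := mem_superPerm.1 hB
    rcases mem_splitBlock.1 h with ⟨h', rfl⟩ | ⟨-, x, hx, rfl⟩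
    · exact absurd h' h0
    · simp

lemma card_unionNZ_superPerm (u : NCMon) : (unionNZ u.superPerm).card = u.w.length := by
  rw [unionNZ_eq_Icc fun x hx => u.blockCount_superPerm hx]; simp

lemma length_superPerm (u : NCMon) :
    u.superPerm.length = ∑ a ∈ u.ind, (splitBlock (u.block a)).length := by
  rw [superPerm_eq, List.length_flatMap, ← List.sum_toFinset _ (u.ind.sort_nodup _),
    Finset.sort_toFinset]

lemma card_ind_le (u : NCMon) : u.ind.card ≤ u.superPerm.length := by
  rw [length_superPerm, Finset.card_eq_sum_ones]
  refine Finset.sum_le_sum fun a ha => ?_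
  by_cases h : 0 ∈ u.block a
  · simp [splitBlock, h]
  · simpa [splitBlock, h] using block_nonempty ha

lemma length_superPerm_le (u : NCMon) : u.superPerm.length ≤ u.deg := by
  have h : ∀ a ∈ u.ind, (splitBlock (u.block a)).length ≤ (if a ∈ u.S then 1 else 0) +
      ((Finset.range u.w.length).filter fun t => u.w.getD t 0 = a).card := by
    intro a _
    by_cases h : a ∈ u.S
    · simp [splitBlock, zero_mem_block, h]
    · rw [splitBlock, if_neg (mt zero_mem_block.1 h), List.length_map, Finset.length_sort, block,
        if_neg h, if_neg h, Finset.union_empty, zero_add]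
      exact Finset.card_image_le
  rw [length_superPerm]
  refine (Finset.sum_le_sum h).trans ?_
  rw [Finset.sum_add_distrib, ← Finset.card_filter, deg]
  refine add_le_add (Finset.card_le_card fun a => by simp) ?_
  rw [← Finset.card_eq_sum_card_fiberwise, Finset.card_range]
  intro t ht
  rw [Finset.mem_coe, Finset.mem_range] at ht
  change u.w.getD t 0 ∈ u.ind
  rw [List.getD_eq_getElem _ _ ht]
  exact mem_ind.2 (Or.inr (List.getElem_mem ht))

end NCMon

lemma Qfn_apply_of_isSuperPerm {I : List (Finset ℕ)} (hI : IsSuperPerm I) (u : NCMon) :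
    Qfn I u = if u.superPerm = I then 1 else 0 := by
  have : SSle I u.scomp ↔ u.superPerm = I := by
    refine hI.ssle_iff fun B hB => ?_
    rw [NCMon.scomp_eq] at hB
    obtain ⟨a, ha, rfl⟩ := List.mem_map.1 hB
    exact NCMon.block_nonempty (by simpa using ha)
  rw [Qfn_apply]
  simp only [this]

/-! ### Coarsening the index set of a monomial -/

namespace NCMon

/-- Apply `ψ` to all the indices of a monomial. -/
def reindex (ψ : ℕ → ℕ) (u : NCMon) : NCMon := ⟨u.S.image ψ, u.w.map ψ⟩

/-- The reindexing `ψ` of the indices of `u` is monotone, and only identifies indices that are not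
θ-indices and that appear in the word of `u` in increasing order. -/
structure IsCoarsening (ψ : ℕ → ℕ) (u : NCMon) : Prop where
  monotoneOn : MonotoneOn ψ u.ind
  eq_of_mem : ∀ s ∈ u.S, ∀ a ∈ u.ind, ψ a = ψ s → a = s
  pairwise : u.w.Pairwise fun x y => ψ x = ψ y → x ≤ y

lemma ind_reindex (ψ : ℕ → ℕ) (u : NCMon) : (u.reindex ψ).ind = u.ind.image ψ := by
  ext a; simp [ind, reindex, Finset.image_union]

namespace IsCoarsening

variable {ψ : ℕ → ℕ} {u : NCMon}

lemma injOn (h : IsCoarsening ψ u) : Set.InjOn ψ u.S :=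
  fun _ ha _ hb hab => h.eq_of_mem _ hb _ (mem_ind.2 (Or.inl ha)) hab

lemma lt_iff_lt (h : IsCoarsening ψ u) {a b : ℕ} (ha : a ∈ u.S) (hb : b ∈ u.S) :
    ψ a < ψ b ↔ a < b := by
  have hm : StrictMonoOn ψ u.S := by
    have hsub : (u.S : Set ℕ) ⊆ u.ind := fun x hx => mem_ind.2 (Or.inl hx)
    exact (h.monotoneOn.mono hsub).strictMonoOn_of_injOn h.injOn
  exact hm.lt_iff_lt ha hb

/-- Coarsenings restrict to submonomials. -/
lemma of_sublist (h : IsCoarsening ψ u) {S : Finset ℕ} {w : List ℕ} (hS : S ⊆ u.S)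
    (hw : w.Sublist u.w) : IsCoarsening ψ ⟨S, w⟩ := by
  have hind : ∀ a, a ∈ (⟨S, w⟩ : NCMon).ind → a ∈ u.ind := fun a ha =>
    mem_ind.2 ((mem_ind.1 ha).imp (fun h => hS h) fun h => hw.subset h)
  exact ⟨h.monotoneOn.mono hind, fun s hs a ha => h.eq_of_mem s (hS hs) a (hind a ha),
    h.pairwise.sublist hw⟩

lemma superPerm_reindex (h : IsCoarsening ψ u) : (u.reindex ψ).superPerm = u.superPerm := by
  have hsort : u.ind.sort =
      (u.ind.image ψ).sort.flatMap fun b => (u.ind.filter fun a => ψ a = b).sort := by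
    refine sort_eq_flatMap ((u.ind.image ψ).sortedLT_sort.pairwise.imp fun hab x hx y hy => ?_)
      fun x => by simpa using fun hx => ⟨x, hx, rfl⟩
    rw [Finset.mem_filter] at hx hy
    by_contra! hyx
    have := h.monotoneOn hy.1 hx.1 hyx
    omega
  rw [superPerm_eq, superPerm_eq, hsort, ind_reindex, List.flatMap_assoc]
  refine List.flatMap_congr fun b _ => ?_
  by_cases hbS : b ∈ u.S.image ψ
  · obtain ⟨s, hs, rfl⟩ := Finset.mem_image.1 hbS
    have hfib : (u.ind.filter fun a => ψ a = ψ s) = {s} := by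
      ext a
      rw [Finset.mem_filter, Finset.mem_singleton]
      refine ⟨fun ha => h.eq_of_mem s hs a ha.1 ha.2, ?_⟩
      rintro rfl
      exact ⟨mem_ind.2 (Or.inl hs), rfl⟩
    have hblock : (u.reindex ψ).block (ψ s) = u.block s := by
      ext x
      cases x with
      | zero => rw [zero_mem_block, zero_mem_block]; exact iff_of_true hbS hs
      | succ t =>
        rw [succ_mem_block, succ_mem_block]
        simp only [reindex, List.getElem?_map, Option.map_eq_some_iff]
        constructor
        · rintro ⟨a, ha, hab⟩
          rw [ha, h.eq_of_mem s hs a (mem_ind.2 (Or.inr (List.mem_of_getElem? ha))) hab]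
        · exact fun ha => ⟨s, ha, rfl⟩
    rw [hfib, hblock]
    simp
  · refine splitBlock_eq_flatMap ?_ (fun x => ?_) (mt zero_mem_block.1 hbS)
    · refine (Finset.sortedLT_sort _).pairwise.imp_of_mem fun {a a'} ha ha' haa' x hx y hy => ?_
      rw [Finset.mem_sort, Finset.mem_filter] at ha ha'
      have hne : ∀ c, ψ c = b → 0 ∉ u.block c := fun c hc h0 =>
        hbS (Finset.mem_image.2 ⟨c, zero_mem_block.1 h0, hc⟩)
      obtain ⟨t, rfl⟩ := Nat.exists_eq_succ_of_ne_zero (n := x) fun h0 => hne a ha.2 (h0 ▸ hx)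
      obtain ⟨t', rfl⟩ := Nat.exists_eq_succ_of_ne_zero (n := y) fun h0 => hne a' ha'.2 (h0 ▸ hy)
      rw [Nat.succ_eq_add_one, succ_mem_block, List.getElem?_eq_some_iff] at hx hy
      obtain ⟨ht, rfl⟩ := hx
      obtain ⟨ht', rfl⟩ := hy
      rcases lt_trichotomy t t' with htt | rfl | htt
      · omega
      · omega
      · have := List.pairwise_iff_getElem.1 h.pairwise t' t ht' ht htt (by rw [ha.2, ha'.2])
        omega
    · simp only [Finset.mem_sort, Finset.mem_filter]
      cases x with
      | zero =>
        rw [zero_mem_block]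
        simp only [zero_mem_block]
        refine iff_of_false hbS ?_
        rintro ⟨a, ⟨-, ha⟩, haS⟩
        exact hbS (Finset.mem_image.2 ⟨a, haS, ha⟩)
      | succ t =>
        rw [succ_mem_block]
        simp only [succ_mem_block, reindex, List.getElem?_map, Option.map_eq_some_iff]
        constructor
        · rintro ⟨a, ha, hab⟩
          exact ⟨a, ⟨mem_ind.2 (Or.inr (List.mem_of_getElem? ha)), hab⟩, ha⟩
        · rintro ⟨a, ⟨-, hab⟩, ha⟩
          exact ⟨a, ha, hab⟩

end IsCoarsening

/-- The blocks of `u.superPerm`, labelled by the corresponding index of `u`. -/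
def labelledBlocks (u : NCMon) : List (ℕ × Finset ℕ) :=
  u.ind.sort.flatMap fun a => (splitBlock (u.block a)).map (Prod.mk a)

lemma labelledBlocks_map_snd (u : NCMon) : u.labelledBlocks.map Prod.snd = u.superPerm := by
  simp [labelledBlocks, superPerm_eq, List.map_flatMap, Function.comp_def]

lemma mem_labelledBlocks {u : NCMon} {a : ℕ} {B : Finset ℕ} :
    (a, B) ∈ u.labelledBlocks ↔ a ∈ u.ind ∧ B ∈ splitBlock (u.block a) := by
  simp [labelledBlocks]

lemma pairwise_labelledBlocks (u : NCMon) : u.labelledBlocks.Pairwise fun p q =>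
    p.1 < q.1 ∨ p.1 = q.1 ∧ 0 ∉ p.2 ∧ 0 ∉ q.2 ∧ ∀ x ∈ p.2, ∀ y ∈ q.2, x < y := by
  rw [labelledBlocks, List.pairwise_flatMap]
  refine ⟨fun a _ => ?_, u.ind.sortedLT_sort.pairwise.imp fun h => ?_⟩
  · rw [List.pairwise_map]
    by_cases h : 0 ∈ u.block a
    · simp [splitBlock, h]
    · rw [splitBlock, if_neg h, List.pairwise_map]
      refine (Finset.sortedLT_sort _).pairwise.imp_of_mem fun {x y} hx hy hxy => ?_
      rw [Finset.mem_sort] at hx hy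
      refine Or.inr ⟨rfl, ?_, ?_, by simpa using hxy⟩ <;>
        · rw [Finset.mem_singleton]; rintro rfl; exact h ‹_›
  · simp only [List.mem_map]
    rintro _ ⟨_, _, rfl⟩ _ ⟨_, _, rfl⟩
    exact Or.inl h

end NCMon

/-- The finest monomial whose set supercomposition is `K`, for a superpermutation `K`. -/
def toMon (K : List (Finset ℕ)) : NCMon :=
  ⟨(Finset.range K.length).filter fun r => 0 ∈ K.getD r ∅,
    (List.range (unionNZ K).card).map fun t => K.findIdx fun B => t + 1 ∈ B⟩

lemma NCMon.exists_isCoarsening (u : NCMon) :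
    ∃ ψ, NCMon.IsCoarsening ψ (toMon u.superPerm) ∧ (toMon u.superPerm).reindex ψ = u := by
  set l := u.labelledBlocks with hl
  have hlen : u.superPerm.length = l.length := by rw [← labelledBlocks_map_snd, List.length_map]
  have hget : ∀ r (hr : r < l.length), u.superPerm[r]'(by omega) = l[r].2 := by
    intro r hr
    simp only [← labelledBlocks_map_snd, List.getElem_map, hl]
  have hpw := List.pairwise_iff_getElem.1 u.pairwise_labelledBlocks
  rw [← hl] at hpw
  have hmem : ∀ r (hr : r < l.length), l[r].1 ∈ u.ind ∧ l[r].2 ∈ splitBlock (u.block l[r].1) :=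
    fun r hr => mem_labelledBlocks.1 (List.getElem_mem hr)
  have hidx : ∀ t < u.w.length, ∃ hr : (u.superPerm.findIdx fun B => t + 1 ∈ B) < l.length,
      t + 1 ∈ l[u.superPerm.findIdx fun B => t + 1 ∈ B].2 := by
    intro t ht
    have h1 : 0 < blockCount (t + 1) u.superPerm := by
      rw [blockCount_superPerm u (by omega), if_pos (by omega)]; simp
    have h2 : (u.superPerm.findIdx fun B => t + 1 ∈ B) < u.superPerm.length :=
      List.findIdx_lt_length_of_exists (by simpa [blockCount_pos] using h1)
    refine ⟨hlen ▸ h2, ?_⟩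
    rw [← hget]
    simpa using List.findIdx_getElem (w := h2)
  have hS : ∀ r, r ∈ (toMon u.superPerm).S ↔ ∃ hr : r < l.length, 0 ∈ l[r].2 := by
    intro r
    simp only [toMon, Finset.mem_filter, Finset.mem_range, hlen]
    constructor
    · rintro ⟨hr, h0⟩
      rw [List.getD_eq_getElem _ _ (by omega), hget r hr] at h0
      exact ⟨hr, h0⟩
    · rintro ⟨hr, h0⟩
      rw [List.getD_eq_getElem _ _ (by omega), hget r hr]
      exact ⟨hr, h0⟩
  have hind : ∀ r ∈ (toMon u.superPerm).ind, r < l.length := by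
    intro r hr
    rcases mem_ind.1 hr with h | h
    · exact ((hS r).1 h).1
    · simp only [toMon, List.mem_map, List.mem_range, card_unionNZ_superPerm] at h
      obtain ⟨t, ht, rfl⟩ := h
      exact (hidx t ht).1
  set ψ : ℕ → ℕ := fun r => (l.getD r (0, ∅)).1 with hψ
  have hψr : ∀ r (hr : r < l.length), ψ r = l[r].1 := by
    intro r hr
    simp only [hψ, List.getD_eq_getElem _ _ hr]
  refine ⟨ψ, ⟨?_, ?_, ?_⟩, ?_⟩
  · intro r hr r' hr' h
    have hr := hind r hr
    have hr' := hind r' hr'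
    rw [hψr r hr, hψr r' hr']
    rcases h.eq_or_lt with rfl | h
    · rfl
    · have := hpw r r' hr hr' h
      omega
  · intro s hs a ha h
    obtain ⟨hs, h0⟩ := (hS s).1 hs
    have ha := hind a ha
    rw [hψr a ha, hψr s hs] at h
    rcases lt_trichotomy a s with has | has | has
    · rcases hpw a s ha hs has with h' | h'
      · omega
      · exact absurd h0 h'.2.2.1
    · exact has
    · rcases hpw s a hs ha has with h' | h'
      · omega
      · exact absurd h0 h'.2.1
  · simp only [toMon, List.pairwise_map, card_unionNZ_superPerm]
    refine List.pairwise_lt_range.imp_of_mem fun {t t'} ht ht' htt h => ?_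
    rw [List.mem_range] at ht ht'
    obtain ⟨hr, hmr⟩ := hidx t ht
    obtain ⟨hr', hmr'⟩ := hidx t' ht'
    by_contra! hlt
    rw [hψr _ hr, hψr _ hr'] at h
    rcases hpw _ _ hr' hr hlt with h' | h'
    · omega
    · have := h'.2.2.2 _ hmr' _ hmr
      omega
  · have h1 : (toMon u.superPerm).S.image ψ = u.S := by
      ext a
      rw [Finset.mem_image]
      constructor
      · rintro ⟨r, hr, rfl⟩
        obtain ⟨hr, h0⟩ := (hS r).1 hr
        rw [hψr r hr]
        exact zero_mem_block.1 (subset_of_mem_splitBlock (hmem r hr).2 h0)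
      · intro ha
        have h0 : 0 ∈ u.block a := zero_mem_block.2 ha
        have : (a, u.block a) ∈ l :=
          mem_labelledBlocks.2 ⟨mem_ind.2 (Or.inl ha), mem_splitBlock.2 (Or.inl ⟨h0, rfl⟩)⟩
        obtain ⟨r, hr, hlr⟩ := List.mem_iff_getElem.1 this
        exact ⟨r, (hS r).2 ⟨hr, by rwa [hlr]⟩, by rw [hψr r hr, hlr]⟩
    have h2 : (toMon u.superPerm).w.map ψ = u.w := by
      refine List.ext_getElem (by simp [toMon, card_unionNZ_superPerm]) fun t _ ht => ?_
      obtain ⟨hr, hmr⟩ := hidx t ht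
      have := succ_mem_block.1 (subset_of_mem_splitBlock (hmem _ hr).2 hmr)
      simp only [toMon, List.map_map, List.getElem_map, List.getElem_range, Function.comp]
      rw [hψr _ hr]
      rw [List.getElem?_eq_getElem ht] at this
      exact (Option.some.inj this).symm
    exact congrArg₂ NCMon.mk h1 h2

/-! ### The functions constant along coarsenings -/

/-- The functions of bounded degree that are invariant under coarsening of monomials. -/
structure IsCoarseningInvariant (f : NCMon → ℚ) : Prop where
  apply_reindex : ∀ ψ u, NCMon.IsCoarsening ψ u → f (u.reindex ψ) = f u
  bddDeg : BddDeg f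

lemma IsCoarseningInvariant.apply_toMon {f : NCMon → ℚ} (hf : IsCoarseningInvariant f)
    (u : NCMon) : f (toMon u.superPerm) = f u := by
  obtain ⟨ψ, hψ, h⟩ := u.exists_isCoarsening
  rw [← hf.apply_reindex ψ _ hψ, h]

lemma IsSuperPerm.isCoarseningInvariant {I : List (Finset ℕ)} (hI : IsSuperPerm I) :
    IsCoarseningInvariant (Qfn I) := by
  refine ⟨fun ψ u h => ?_, I.length + (unionNZ I).card, fun u hu => ?_⟩
  · rw [Qfn_apply_of_isSuperPerm hI, Qfn_apply_of_isSuperPerm hI, h.superPerm_reindex]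
  · rw [Qfn_apply_of_isSuperPerm hI] at hu
    have h : u.superPerm = I := by by_contra h; exact hu (if_neg h)
    rw [← h, u.card_unionNZ_superPerm, NCMon.deg]
    have h1 := u.card_ind_le
    have h2 : u.S.card ≤ u.ind.card := Finset.card_le_card Finset.subset_union_left
    omega

lemma isCoarseningInvariant_of_mem_sFQSym {f : NCMon → ℚ} (hf : f ∈ sFQSym) :
    IsCoarseningInvariant f := by
  induction hf using Submodule.span_induction with
  | mem f hf =>
    obtain ⟨I, hI, rfl⟩ := hf
    exact hI.isCoarseningInvariant
  | zero => exact ⟨fun _ _ _ => rfl, 0, fun u hu => absurd rfl hu⟩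
  | add f g _ _ hf hg =>
    obtain ⟨N, hN⟩ := hf.bddDeg
    obtain ⟨M, hM⟩ := hg.bddDeg
    refine ⟨fun ψ u h => ?_, max N M, fun u hu => ?_⟩
    · rw [Pi.add_apply, Pi.add_apply, hf.apply_reindex ψ u h, hg.apply_reindex ψ u h]
    · by_cases h : f u = 0
      · exact (hM u fun h' => hu (by rw [Pi.add_apply, h, h', add_zero])).trans (le_max_right _ _)
      · exact (hN u h).trans (le_max_left _ _)
  | smul c f _ hf =>
    obtain ⟨N, hN⟩ := hf.bddDeg
    refine ⟨fun ψ u h => ?_, N, fun u hu => hN u fun h => hu ?_⟩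
    · rw [Pi.smul_apply, Pi.smul_apply, hf.apply_reindex ψ u h]
    · rw [Pi.smul_apply, h, smul_zero]

lemma exists_finset_superPerm (N : ℕ) : ∃ F : Finset (List (Finset ℕ)),
    (∀ K ∈ F, IsSuperPerm K) ∧ ∀ u : NCMon, u.deg ≤ N → u.superPerm ∈ F := by
  have hfin : {K : List (Finset ℕ) | IsSuperPerm K ∧ K.length ≤ N ∧
      ∀ B ∈ K, B ⊆ Finset.range (N + 1)}.Finite :=
    finite_lists_of_subset.subset fun K hK => hK.2
  refine ⟨hfin.toFinset, fun K hK => (hfin.mem_toFinset.1 hK).1, fun u hu =>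
    hfin.mem_toFinset.2 ⟨u.isSuperPerm_superPerm, u.length_superPerm_le.trans hu, ?_⟩⟩
  intro B hB x hx
  rw [Finset.mem_range]
  by_cases h0 : x = 0
  · omega
  · have h1 := blockCount_pos.2 ⟨B, hB, hx⟩
    rw [u.blockCount_superPerm h0] at h1
    split_ifs at h1
    · rw [NCMon.deg] at hu
      omega
    · omega

lemma sum_mul_Qfn {F : Finset (List (Finset ℕ))} (hF : ∀ K ∈ F, IsSuperPerm K)
    (c : List (Finset ℕ) → ℚ) (u : NCMon) :
    ∑ K ∈ F, c K * Qfn K u = if u.superPerm ∈ F then c u.superPerm else 0 := by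
  rw [← Finset.sum_ite_eq F u.superPerm c]
  refine Finset.sum_congr rfl fun K hK => ?_
  rw [Qfn_apply_of_isSuperPerm (hF K hK)]
  split_ifs <;> simp

lemma mem_sFQSym_iff {f : NCMon → ℚ} : f ∈ sFQSym ↔ IsCoarseningInvariant f := by
  refine ⟨isCoarseningInvariant_of_mem_sFQSym, fun hf => ?_⟩
  obtain ⟨N, hN⟩ := hf.bddDeg
  obtain ⟨F, hF, hmem⟩ := exists_finset_superPerm N
  have h : f = ∑ K ∈ F, f (toMon K) • Qfn K := by
    ext u
    simp only [Finset.sum_apply, Pi.smul_apply, smul_eq_mul]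
    rw [sum_mul_Qfn hF fun K => f (toMon K), hf.apply_toMon]
    split_ifs with hu
    · rfl
    · by_contra h
      exact hu (hmem u (hN u h))
  rw [h]
  exact Submodule.sum_mem _ fun K hK =>
    Submodule.smul_mem _ _ (Submodule.subset_span ⟨K, hF K hK, rfl⟩)

/-! ### Product -/

lemma invST_image {ψ : ℕ → ℕ} {S T : Finset ℕ} (hS : Set.InjOn ψ S) (hT : Set.InjOn ψ T)
    (h : ∀ a ∈ S, ∀ b ∈ T, ψ b < ψ a ↔ b < a) :
    invST (S.image ψ) (T.image ψ) = invST S T := by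
  rw [invST, invST]
  symm
  refine Finset.card_bij (fun p _ => (ψ p.1, ψ p.2)) ?_ ?_ ?_
  · rintro ⟨a, b⟩ hp
    simp only [Finset.mem_filter, Finset.mem_product] at hp ⊢
    exact ⟨⟨Finset.mem_image_of_mem _ hp.1.1, Finset.mem_image_of_mem _ hp.1.2⟩,
      (h a hp.1.1 b hp.1.2).2 hp.2⟩
  · rintro ⟨a, b⟩ hp ⟨a', b'⟩ hp' heq
    simp only [Finset.mem_filter, Finset.mem_product, Prod.mk.injEq] at hp hp' heq
    rw [hS hp.1.1 hp'.1.1 heq.1, hT hp.1.2 hp'.1.2 heq.2]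
  · rintro ⟨x, y⟩ hp
    simp only [Finset.mem_filter, Finset.mem_product, Finset.mem_image] at hp
    obtain ⟨⟨⟨a, ha, rfl⟩, b, hb, rfl⟩, hab⟩ := hp
    exact ⟨(a, b), by simp [ha, hb, (h a ha b hb).1 hab], rfl⟩

lemma IsCoarseningInvariant.mulF {f g : NCMon → ℚ} (hf : IsCoarseningInvariant f)
    (hg : IsCoarseningInvariant g) : IsCoarseningInvariant (mulF f g) := by
  refine ⟨fun ψ u h => ?_, ?_⟩
  · have hinj : Set.InjOn (fun S : Finset ℕ => S.image ψ) u.S.powerset := by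
      intro S hS T hT hST
      simp only [Finset.coe_powerset, Set.mem_preimage, Set.mem_powerset_iff,
        Finset.coe_subset] at hS hT
      have : ψ '' (S : Set ℕ) = ψ '' T := by simpa using congrArg ((↑) : Finset ℕ → Set ℕ) hST
      exact_mod_cast (h.injOn.image_eq_image_iff hS hT).1 this
    simp only [_root_.mulF, NCMon.reindex, List.length_map, Finset.powerset_image]
    refine Finset.sum_congr rfl fun k _ => ?_
    rw [Finset.sum_image hinj]
    refine Finset.sum_congr rfl fun S hS => ?_
    rw [Finset.mem_powerset] at hS
    rw [← Finset.image_sdiff_of_injOn h.injOn hS, ← List.map_take, ← List.map_drop,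
      invST_image (h.injOn.mono hS) (h.injOn.mono Finset.sdiff_subset)
        fun a ha b hb => h.lt_iff_lt (Finset.sdiff_subset hb) (hS ha),
      ← hf.apply_reindex ψ _ (h.of_sublist hS (List.take_sublist k _)),
      ← hg.apply_reindex ψ _ (h.of_sublist Finset.sdiff_subset (List.drop_sublist k _))]
    rfl
  · obtain ⟨N, hN⟩ := hf.bddDeg
    obtain ⟨M, hM⟩ := hg.bddDeg
    refine ⟨N + M, fun u hu => ?_⟩
    obtain ⟨k, hk, hk0⟩ := Finset.exists_ne_zero_of_sum_ne_zero hu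
    obtain ⟨S, hS, h0⟩ := Finset.exists_ne_zero_of_sum_ne_zero hk0
    have h1 := hN _ (right_ne_zero_of_mul (left_ne_zero_of_mul h0))
    have h2 := hM _ (right_ne_zero_of_mul h0)
    rw [Finset.mem_powerset] at hS
    have h3 := Finset.card_sdiff_add_card_eq_card hS
    simp only [NCMon.deg, List.length_take, List.length_drop] at h1 h2 ⊢
    omega

/-! ### Coproduct -/

namespace NCMon

lemma ind_starMon (u v : NCMon) :
    (starMon u v).ind = u.ind ∪ v.ind.image (· + (u.ind.sup id + 1)) := by
  ext a
  simp only [ind, starMon, List.toFinset_append, Finset.mem_union, Finset.mem_image,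
    List.mem_toFinset, List.mem_map, or_and_right, exists_or]
  exact or_or_or_comm

lemma deg_starMon (u v : NCMon) : (starMon u v).deg = u.deg + v.deg := by
  have hdisj : Disjoint u.S (v.S.image (· + (u.ind.sup id + 1))) := by
    rw [Finset.disjoint_left]
    intro a ha hav
    obtain ⟨b, -, rfl⟩ := Finset.mem_image.1 hav
    have : b + (u.ind.sup id + 1) ≤ u.ind.sup id :=
      Finset.le_sup (f := id) (mem_ind.2 (Or.inl ha))
    omega
  rw [deg, deg, deg, starMon, Finset.card_union_of_disjoint hdisj,
    Finset.card_image_of_injective _ (add_left_injective _)]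
  simp only [List.length_append, List.length_map]
  omega

lemma lt_sup_add_one {u : NCMon} {a : ℕ} (ha : a ∈ u.ind) : a < u.ind.sup id + 1 :=
  Nat.lt_succ_of_le (Finset.le_sup (f := id) ha)

/-- Coarsenings of two monomials glue to a coarsening of their shifted concatenation. -/
lemma IsCoarsening.exists_starMon {ψ φ : ℕ → ℕ} {u v : NCMon} (hu : IsCoarsening ψ u)
    (hv : IsCoarsening φ v) : ∃ χ, IsCoarsening χ (starMon u v) ∧
      (starMon u v).reindex χ = starMon (u.reindex ψ) (v.reindex φ) := by
  set n := u.ind.sup id + 1 with hn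
  set m := (u.reindex ψ).ind.sup id + 1 with hm
  have hun : ∀ a ∈ u.ind, a < n := fun a ha => lt_sup_add_one ha
  have hum : ∀ a ∈ u.ind, ψ a < m := fun a ha =>
    lt_sup_add_one (by rw [ind_reindex]; exact Finset.mem_image_of_mem _ ha)
  have huS : ∀ a ∈ u.S, a ∈ u.ind := fun a ha => mem_ind.2 (Or.inl ha)
  have huw : ∀ a ∈ u.w, a ∈ u.ind := fun a ha => mem_ind.2 (Or.inr ha)
  have hvS : ∀ a ∈ v.S, a ∈ v.ind := fun a ha => mem_ind.2 (Or.inl ha)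
  set χ : ℕ → ℕ := fun x => if x < n then ψ x else φ (x - n) + m with hχ
  have hχu : ∀ a ∈ u.ind, χ a = ψ a := fun a ha => if_pos (hun a ha)
  have hχv : ∀ a, χ (a + n) = φ a + m := fun a => by simp [hχ]
  have hind : ∀ a ∈ (starMon u v).ind, a ∈ u.ind ∨ ∃ b ∈ v.ind, a = b + n := by
    intro a ha
    rw [ind_starMon, Finset.mem_union, Finset.mem_image] at ha
    exact ha.imp_right fun ⟨b, hb, h⟩ => ⟨b, hb, h.symm⟩
  refine ⟨χ, ⟨?_, ?_, ?_⟩, ?_⟩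
  · intro a ha b hb hab
    rcases hind a ha with ha | ⟨a, ha', rfl⟩ <;> rcases hind b hb with hb | ⟨b, hb', rfl⟩
    · rw [hχu a ha, hχu b hb]
      exact hu.monotoneOn ha hb hab
    · rw [hχu a ha, hχv]
      exact (hum a ha).le.trans (Nat.le_add_left _ _)
    · have := hun b hb
      omega
    · rw [hχv, hχv]
      exact Nat.add_le_add_right (hv.monotoneOn ha' hb' (by omega)) _
  · intro s hs a ha h
    simp only [starMon, Finset.mem_union, Finset.mem_image] at hs
    rcases hs with hs | ⟨s, hs, rfl⟩ <;> rcases hind a ha with ha | ⟨a, ha', rfl⟩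
    · rw [hχu a ha, hχu s (huS s hs)] at h
      exact hu.eq_of_mem s hs a ha h
    · rw [hχv, hχu s (huS s hs)] at h
      have := hum s (huS s hs)
      omega
    · rw [← hn, hχv, hχu a ha] at h
      have := hum a ha
      omega
    · rw [← hn, hχv, hχv] at h
      rw [← hn, hv.eq_of_mem s hs a ha' (by omega)]
  · rw [starMon, List.pairwise_append, List.pairwise_map]
    refine ⟨hu.pairwise.imp_of_mem fun {a b} ha hb h hab => ?_, hv.pairwise.imp ?_, ?_⟩
    · rw [hχu a (huw a ha), hχu b (huw b hb)] at hab
      exact h hab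
    · intro a b h hab
      rw [← hn, hχv, hχv] at hab
      have := h (by omega)
      omega
    · intro a ha b hb h
      obtain ⟨b, -, rfl⟩ := List.mem_map.1 hb
      have := hun a (huw a ha)
      omega
  · have h1 : (starMon u v).S.image χ = (starMon (u.reindex ψ) (v.reindex φ)).S := by
      simp only [starMon, reindex, Finset.image_union, Finset.image_image]
      congr 1
      · exact Finset.image_congr fun a ha => hχu a (huS a ha)
      · exact Finset.image_congr fun a _ => hχv a
    have h2 : (starMon u v).w.map χ = (starMon (u.reindex ψ) (v.reindex φ)).w := by
      simp only [starMon, reindex, List.map_append, List.map_map]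
      congr 1
      · exact List.map_congr_left fun a ha => hχu a (huw a ha)
      · exact List.map_congr_left fun a _ => hχv a
    exact congrArg₂ NCMon.mk h1 h2

end NCMon

lemma IsCoarseningInvariant.apply_starMon_toMon {f : NCMon → ℚ} (hf : IsCoarseningInvariant f)
    (u v : NCMon) : f (starMon (toMon u.superPerm) (toMon v.superPerm)) = f (starMon u v) := by
  obtain ⟨ψ, hψ, hu⟩ := u.exists_isCoarsening
  obtain ⟨φ, hφ, hv⟩ := v.exists_isCoarsening
  obtain ⟨χ, hχ, h⟩ := hψ.exists_starMon hφ
  rw [← hf.apply_reindex χ _ hχ, h, hu, hv]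

lemma IsCoarseningInvariant.deltaF_mem_span {f : NCMon → ℚ} (hf : IsCoarseningInvariant f) :
    DeltaF f ∈ Submodule.span ℚ {F : NCMon → NCMon → ℚ |
      ∃ A B : List (Finset ℕ), IsSuperPerm A ∧ IsSuperPerm B ∧
        F = fun u v => Qfn A u * Qfn B v} := by
  obtain ⟨N, hN⟩ := hf.bddDeg
  obtain ⟨F, hF, hmem⟩ := exists_finset_superPerm N
  have h : DeltaF f = ∑ A ∈ F, ∑ B ∈ F,
      f (starMon (toMon A) (toMon B)) • fun u v => Qfn A u * Qfn B v := by
    ext u v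
    have h1 : ∀ A B, f (starMon (toMon A) (toMon B)) * (Qfn A u * Qfn B v) =
        f (starMon (toMon A) (toMon B)) * Qfn B v * Qfn A u := fun A B => by ring
    simp only [Finset.sum_apply, Pi.smul_apply, smul_eq_mul, h1, ← Finset.sum_mul]
    rw [sum_mul_Qfn hF fun A => ∑ B ∈ F, f (starMon (toMon A) (toMon B)) * Qfn B v,
      sum_mul_Qfn hF fun B => f (starMon (toMon u.superPerm) (toMon B)),
      hf.apply_starMon_toMon]
    by_cases h0 : f (starMon u v) = 0
    · simp [DeltaF, h0]
    · have := hN _ h0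
      rw [NCMon.deg_starMon] at this
      rw [if_pos (hmem u (by omega)), if_pos (hmem v (by omega)), DeltaF]
  rw [h]
  exact Submodule.sum_mem _ fun A hA => Submodule.sum_mem _ fun B hB =>
    Submodule.smul_mem _ _ (Submodule.subset_span ⟨A, B, hF A hA, hF B hB, rfl⟩)

/-- **Proposition.** If `I` and `J` are superpermutations, every `(I,J)`-super-shuffle is
a superpermutation; moreover, for a superpermutation `I = (I_1, …, I_k)` and `0 ≤ i ≤ k`,
both `std(I_1,…,I_i)` and `std(I_{i+1},…,I_k)` are superpermutations. Consequently, the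
span `sFQSym` of `{Q_I : I a superpermutation}` is closed under the product and under the
coproduct `Δ` of `sNCQSym`, i.e. `sFQSym` is a sub-Hopf superalgebra of `sNCQSym`. -/
theorem sFQSym_sub_Hopf :
    (∀ I J : List (Finset ℕ), IsSuperPerm I → IsSuperPerm J →
      ∀ (L : List (Bool × Finset ℕ)) (K : List (Finset ℕ)),
        IsShuffle I (shiftC (unionNZ I).card J) L → SMerge L K → IsSuperPerm K) ∧
    (∀ I : List (Finset ℕ), IsSuperPerm I → ∀ i ≤ I.length,
      IsSuperPerm (stdSeq (I.take i)) ∧ IsSuperPerm (stdSeq (I.drop i))) ∧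
    (∀ f g : NCMon → ℚ, f ∈ sFQSym → g ∈ sFQSym → mulF f g ∈ sFQSym) ∧
    (∀ f : NCMon → ℚ, f ∈ sFQSym →
      DeltaF f ∈ Submodule.span ℚ {F : NCMon → NCMon → ℚ |
        ∃ A B : List (Finset ℕ), IsSuperPerm A ∧ IsSuperPerm B ∧
          F = fun u v => Qfn A u * Qfn B v}) := by
  refine ⟨fun I J hI hJ L K => hI.of_superShuffle hJ, fun I hI i _ =>
    ⟨hI.stdSeq_of_sublist (List.take_sublist i I), hI.stdSeq_of_sublist (List.drop_sublist i I)⟩,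
    fun f g hf hg => ?_, fun f hf => (mem_sFQSym_iff.1 hf).deltaF_mem_span⟩
  rw [mem_sFQSym_iff] at hf hg ⊢
  exact hf.mulF hg
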